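/- Let T be a simple tile of a periodic solution with temporal period τ and spatial period σ over ℤ_n, with columns A_0, …, A_{σ−1} viewed as labels of length τ, and let y = rank(T). For a uniformly random n-state 2-neighbor rule f, the conditional probability that A_i ⇒ A_{(i+1) mod σ} for all i = 0, …, σ−1, given that A_i → A_{(i+1) mod σ} for all i = 0, …, σ−1, equals ((n^τ − (n−1)^τ)/n^τ)^y. -/

import Mathlib

open Filter

/-- An `n`-state 2-neighbor cellular automaton rule. -/
abbrev CARule (n : ℕ) := Fin n → Fin n → Fin n

/-- One step of the CA evolution: `ξ_{t+1}(x) = f(ξ_t(x-1), ξ_t(x))`. -/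
def caStep {n : ℕ} (f : CARule n) (ξ : ℤ → Fin n) : ℤ → Fin n :=
  fun x => f (ξ (x - 1)) (ξ x)

/-- The trajectory of an initial configuration under the rule `f`. -/
def caTraj {n : ℕ} (f : CARule n) (ξ : ℤ → Fin n) : ℕ → ℤ → Fin n
  | 0 => ξ
  | t + 1 => caStep f (caTraj f ξ t)

/-- `ξ` is (the initial configuration of) a periodic solution of `f` with
minimal temporal period `τ` and minimal spatial period `σ`. -/
def IsPS {n : ℕ} (f : CARule n) (ξ : ℤ → Fin n) (τ σ : ℕ) : Prop :=
  0 < τ ∧ 0 < σ ∧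
  (∀ x : ℤ, ξ (x + (σ : ℤ)) = ξ x) ∧
  (∀ σ' : ℕ, 0 < σ' → (∀ x : ℤ, ξ (x + (σ' : ℤ)) = ξ x) → σ ≤ σ') ∧
  caTraj f ξ τ = ξ ∧
  (∀ τ' : ℕ, 0 < τ' → caTraj f ξ τ' = ξ → τ ≤ τ')

/-- `η` is a proper initial configuration for the periodic solution `ξ`:
it agrees with `ξ` at all sites `≤ y` for some `y`. -/
def IsProper {n : ℕ} (ξ η : ℤ → Fin n) : Prop :=
  ∃ y : ℤ, ∀ x ≤ y, η x = ξ x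

/-- The periodic solution `ξ` of `f` is weakly robust: the expansion velocity is
positive, i.e. there is `v > 0` such that for every proper initial configuration
`η`, eventually (in `t`) the two trajectories agree at all sites `x ≤ v·t`
(equivalently, `inf_η liminf_t s_t(η)/t > 0`). -/
def IsWeaklyRobust {n : ℕ} (f : CARule n) (ξ : ℤ → Fin n) : Prop :=
  ∃ v : ℝ, 0 < v ∧ ∀ η : ℤ → Fin n, IsProper ξ η →
    ∀ᶠ t : ℕ in atTop, ∀ x : ℤ, (x : ℝ) ≤ v * t → caTraj f η t x = caTraj f ξ t x

/-- The label (τ-periodic sequence) `A` right-extends to `B` under `f`: `A → B`. -/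
def RightExtends {n : ℕ} (f : CARule n) (A B : ℕ → Fin n) : Prop :=
  ∀ i : ℕ, f (A i) (B i) = B (i + 1)

/-- The sequence `c_{j+1} = f(a_j, c_j)` started at `c₀`. -/
def chaseSeq {n : ℕ} (f : CARule n) (A : ℕ → Fin n) (c₀ : Fin n) : ℕ → Fin n
  | 0 => c₀
  | j + 1 => f (A j) (chaseSeq f A c₀ j)

/-- The label `A` decides `B` under `f`: `A ⇒ B`. -/
def Decides {n : ℕ} (f : CARule n) (A B : ℕ → Fin n) : Prop :=
  RightExtends f A B ∧ ∀ c₀ : Fin n, ∃ j : ℕ, chaseSeq f A c₀ j = B j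

/-- `T` is a (τ,σ)-periodic array (row index mod τ, column index mod σ). -/
def IsTilePeriodic {n : ℕ} (τ σ : ℕ) (T : ℕ → ℕ → Fin n) : Prop :=
  (∀ i j, T (i + τ) j = T i j) ∧ (∀ i j, T i (j + σ) = T i j)

/-- The set of states appearing in the tile `T`. -/
def tileStates (n τ σ : ℕ) (T : ℕ → ℕ → Fin n) : Finset (Fin n) :=
  (Finset.range τ ×ˢ Finset.range σ).image fun p => T p.1 p.2

/-- The set of horizontally adjacent pairs appearing in the tile `T`. -/
def tilePairs (n τ σ : ℕ) (T : ℕ → ℕ → Fin n) : Finset (Fin n × Fin n) :=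
  (Finset.range τ ×ˢ Finset.range σ).image fun p => (T p.1 p.2, T p.1 (p.2 + 1))

/-- `T` is a tile of a periodic solution: uniqueness of assignment, each row has
minimal period `σ`, and the cyclic sequence of rows has minimal period `τ`. -/
def IsPSTile (n τ σ : ℕ) (T : ℕ → ℕ → Fin n) : Prop :=
  IsTilePeriodic τ σ T ∧
  (∀ i j k m, T i j = T k m → T i (j + 1) = T k (m + 1) →
      T (i + 1) (j + 1) = T (k + 1) (m + 1)) ∧
  (∀ i : ℕ, ∀ σ' : ℕ, 0 < σ' → (∀ j, T i (j + σ') = T i j) → σ ≤ σ') ∧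
  (∀ τ' : ℕ, 0 < τ' → (∀ i j, T (i + τ') j = T i j) → τ ≤ τ')

/-- `T` is a tile of a periodic solution of the given rule `f`. -/
def IsPSTileOf {n : ℕ} (f : CARule n) (τ σ : ℕ) (T : ℕ → ℕ → Fin n) : Prop :=
  IsTilePeriodic τ σ T ∧
  (∀ i j, f (T i j) (T i (j + 1)) = T (i + 1) (j + 1)) ∧
  (∀ i : ℕ, ∀ σ' : ℕ, 0 < σ' → (∀ j, T i (j + σ') = T i j) → σ ≤ σ') ∧
  (∀ τ' : ℕ, 0 < τ' → (∀ i j, T (i + τ') j = T i j) → τ ≤ τ')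

/-- `T` is simple: the assignment number `p(T)` equals the number of states `s(T)`. -/
def IsSimpleTile (n τ σ : ℕ) (T : ℕ → ℕ → Fin n) : Prop :=
  (tilePairs n τ σ T).card = (tileStates n τ σ T).card

/-- The rank of a tile: the largest `x` such that some `x` columns of `T`
together contain `x * τ` pairwise distinct states. -/
noncomputable def tileRank (n τ σ : ℕ) (T : ℕ → ℕ → Fin n) : ℕ :=
  sSup {x : ℕ | ∃ J : Finset ℕ, J ⊆ Finset.range σ ∧ J.card = x ∧
    ((J ×ˢ Finset.range τ).image fun p => T p.2 p.1).card = x * τ}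

/-- The tile of the periodic solution `ξ` of `f`: `a_{i,j} = ξ_i(j)`. -/
def psTile {n : ℕ} (f : CARule n) (ξ : ℤ → Fin n) : ℕ → ℕ → Fin n :=
  fun i j => caTraj f ξ i (j : ℤ)

section AbsorbingMaps

open Matrix

/-- The partial self-map `f` leads every point to `none` after finitely many steps. -/
def Absorbing {V : Type*} (f : V → Option V) : Prop :=
  ∀ v, ∃ k : ℕ, (fun o => o.bind f)^[k] (some v) = none

/-- The adjacency matrix of the functional graph of a partial self-map. -/
def stepMatrix {V : Type*} [DecidableEq V] (f : V → Option V) : Matrix V V ℝ :=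
  Matrix.of fun v w => if f v = some w then 1 else 0

theorem iterate_bind_none {V : Type*} (f : V → Option V) (k : ℕ) :
    (fun o : Option V => o.bind f)^[k] none = none :=
  Function.iterate_fixed rfl k

theorem stepMatrix_pow_apply {V : Type*} [Fintype V] [DecidableEq V] (f : V → Option V)
    (k : ℕ) (v w : V) :
    (stepMatrix f ^ k) v w =
      if (fun o => o.bind f)^[k] (some v) = some w then 1 else 0 := by
  induction k generalizing w with
  | zero => simp [Matrix.one_apply]
  | succ k ih =>
    rw [pow_succ, Matrix.mul_apply]
    simp only [ih, Function.iterate_succ_apply']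
    rcases h : (fun o : Option V => o.bind f)^[k] (some v) with _ | u
    · simp
    · simp only [stepMatrix, Matrix.of_apply, Option.some.injEq, Option.bind_some]
      rw [Finset.sum_eq_single u] <;> simp +contextual [eq_comm]

theorem Absorbing.isNilpotent_stepMatrix {V : Type*} [Fintype V] [DecidableEq V]
    {f : V → Option V} (hf : Absorbing f) : IsNilpotent (stepMatrix f) := by
  choose k hk using hf
  refine ⟨∑ v, k v, ?_⟩
  ext v w
  have hle : k v ≤ ∑ v, k v := Finset.single_le_sum (fun _ _ => Nat.zero_le _) (Finset.mem_univ v)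
  obtain ⟨m, hm⟩ := Nat.exists_eq_add_of_le' hle
  rw [stepMatrix_pow_apply, hm, Function.iterate_add_apply, hk, iterate_bind_none]
  simp

theorem det_one_sub_of_isNilpotent {V : Type*} [Fintype V] [DecidableEq V]
    {A : Matrix V V ℝ} (hA : IsNilpotent A) : (1 - A).det = 1 := by
  have h := (Matrix.isNilpotent_charpoly_sub_pow_of_isNilpotent hA).eq_zero
  have h1 := Matrix.eval_charpoly A 1
  rw [sub_eq_zero.mp h] at h1
  simpa using h1.symm

open Classical in
theorem det_one_sub_stepMatrix {V : Type*} [Fintype V] [DecidableEq V] (f : V → Option V) :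
    (1 - stepMatrix f).det = if Absorbing f then 1 else 0 := by
  split_ifs with hf
  · exact det_one_sub_of_isNilpotent hf.isNilpotent_stepMatrix
  · rw [← Matrix.exists_mulVec_eq_zero_iff]
    obtain ⟨v₀, hv₀⟩ := not_forall.mp hf
    refine ⟨fun v => if ∃ k : ℕ, (fun o => o.bind f)^[k] (some v) = none then 0 else 1, ?_, ?_⟩
    · intro h
      simpa [hv₀] using congrFun h v₀
    · ext v
      rw [Matrix.sub_mulVec, Matrix.one_mulVec]
      simp only [Pi.sub_apply, Pi.zero_apply, sub_eq_zero, Matrix.mulVec, dotProduct, stepMatrix,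
        Matrix.of_apply]
      have hstep : (∃ k : ℕ, (fun o => o.bind f)^[k] (some v) = none) ↔
          ∃ k : ℕ, (fun o : Option V => o.bind f)^[k] (f v) = none := by
        constructor
        · rintro ⟨_ | k, hk⟩
          · simp at hk
          · exact ⟨k, by simpa [Function.iterate_succ_apply] using hk⟩
        · rintro ⟨k, hk⟩
          exact ⟨k + 1, by simpa [Function.iterate_succ_apply] using hk⟩
      simp only [hstep]
      rcases f v with _ | w
      · simp [show ∃ k : ℕ, (fun o : Option V => o.bind f)^[k] none = none from ⟨0, rfl⟩]
      · rw [Finset.sum_eq_single w] <;> simp +contextual [eq_comm]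

open Classical in
/-- A weighted matrix-tree identity for functional graphs: every vertex `v` independently makes
a choice `d` of weight `w v d` and moves to `t v d`. -/
theorem sum_prod_absorbing_eq_det {V α : Type*} [Fintype V] [DecidableEq V] [Fintype α]
    (t : V → α → Option V) (w : V → α → ℝ) :
    ∑ h : V → α, (∏ v, w v (h v)) * (if Absorbing (fun v => t v (h v)) then 1 else 0) =
      (Matrix.of fun v u =>
        ∑ d, w v d * ((1 : Matrix V V ℝ) v u - if t v d = some u then 1 else 0)).det := by
  have h := (Matrix.detRowAlternating (n := V) (R := ℝ)).toMultilinearMap.map_sum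
    (fun v d u => w v d * ((1 : Matrix V V ℝ) v u - if t v d = some u then 1 else 0))
  have e : (Matrix.of fun v u =>
      ∑ d, w v d * ((1 : Matrix V V ℝ) v u - if t v d = some u then 1 else 0)) =
      fun v => ∑ d, fun u => w v d * ((1 : Matrix V V ℝ) v u - if t v d = some u then 1 else 0) := by
    ext v u
    simp [Finset.sum_apply]
  rw [e]
  refine Eq.trans (Finset.sum_congr rfl fun g _ => ?_) h.symm
  rw [← det_one_sub_stepMatrix]
  exact (Matrix.det_mul_column (fun v => w v (g v)) _).symm

/-- The cyclic shift on `Fin τ`. -/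
def cycSucc {τ : ℕ} (p : Fin τ) : Fin τ := ⟨(p + 1) % τ, Nat.mod_lt _ p.pos⟩

theorem iterate_cycSucc_val {τ : ℕ} (p : Fin τ) (k : ℕ) :
    ((cycSucc^[k] p : Fin τ) : ℕ) = (p + k) % τ := by
  induction k with
  | zero => simp [Nat.mod_eq_of_lt p.isLt]
  | succ k ih =>
    rw [Function.iterate_succ_apply', cycSucc, Fin.val_mk, ih]
    simp [Nat.add_assoc]

theorem exists_iterate_cycSucc_eq {τ : ℕ} (p q : Fin τ) : ∃ k, cycSucc^[k] p = q := by
  refine ⟨q + τ - p, Fin.ext ?_⟩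
  rw [iterate_cycSucc_val, show (p : ℕ) + (q + τ - p) = q + τ by omega]
  simp [Nat.mod_eq_of_lt q.isLt]

theorem absorbing_cycSucc_iff {τ : ℕ} (hτ : 1 ≤ τ) (h : Fin τ → Bool) :
    Absorbing (fun p => if h p then some (cycSucc p) else none) ↔ h ≠ fun _ => true := by
  set f : Fin τ → Option (Fin τ) := fun p => if h p then some (cycSucc p) else none with hf
  constructor
  · rintro habs rfl
    obtain ⟨k, hk⟩ := habs ⟨0, hτ⟩
    have : ∀ k, (fun o : Option (Fin τ) => o.bind f)^[k] (some ⟨0, hτ⟩) =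
        some (cycSucc^[k] ⟨0, hτ⟩) := by
      intro k
      induction k with
      | zero => rfl
      | succ k ih => rw [Function.iterate_succ_apply', ih, Function.iterate_succ_apply']; rfl
    simp [this] at hk
  · intro hne p
    obtain ⟨q, hq⟩ : ∃ q, h q = false := by
      by_contra! hc
      exact hne (funext fun q => by simpa using hc q)
    obtain ⟨k, hk⟩ := exists_iterate_cycSucc_eq p q
    have : ∀ k, (fun o : Option (Fin τ) => o.bind f)^[k] (some p) = none ∨
        (fun o : Option (Fin τ) => o.bind f)^[k] (some p) = some (cycSucc^[k] p) := by
      intro k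
      induction k with
      | zero => exact Or.inr rfl
      | succ k ih =>
        rcases ih with ih | ih
        · left; rw [Function.iterate_succ_apply', ih]; rfl
        · rw [Function.iterate_succ_apply', ih, Function.iterate_succ_apply' cycSucc]
          by_cases hp : h (cycSucc^[k] p) <;> simp [hf, hp]
    rcases this k with hn | hs
    · exact ⟨k, hn⟩
    · exact ⟨k + 1, by rw [Function.iterate_succ_apply', hs, hk]; simp [hf, hq]⟩

theorem det_one_sub_smul_cycSucc {τ : ℕ} (hτ : 1 ≤ τ) (x : ℝ) :
    (Matrix.of fun p q : Fin τ =>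
      (1 : Matrix (Fin τ) (Fin τ) ℝ) p q - if cycSucc p = q then x else 0).det = 1 - x ^ τ := by
  classical
  have h := sum_prod_absorbing_eq_det
    (fun (p : Fin τ) (b : Bool) => if b then some (cycSucc p) else none)
    (fun _ b => if b then x else 1 - x)
  have e : (Matrix.of fun p q : Fin τ =>
      (1 : Matrix (Fin τ) (Fin τ) ℝ) p q - if cycSucc p = q then x else 0) =
      Matrix.of fun v u => ∑ d : Bool, (if d then x else 1 - x) *
        ((1 : Matrix (Fin τ) (Fin τ) ℝ) v u -
          if (if d then some (cycSucc v) else none) = some u then 1 else 0) := by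
    ext p q
    by_cases hpq : cycSucc p = q <;> simp [hpq] <;> ring
  rw [e, ← h]
  have key : ∀ g : Fin τ → Bool,
      (∏ v, if g v then x else 1 - x) *
        (if Absorbing (fun v => if g v then some (cycSucc v) else none) then 1 else 0) =
      (∏ v, if g v then x else 1 - x) - if g = (fun _ => true) then x ^ τ else 0 := by
    intro g
    by_cases hg : g = fun _ => true
    · have : ¬ Absorbing (fun v => if g v then some (cycSucc v) else none) := by
        rw [absorbing_cycSucc_iff hτ]; simpa using hg
      rw [if_neg this, if_pos hg, hg]
      simp
    · rw [if_pos ((absorbing_cycSucc_iff hτ g).mpr hg), if_neg hg]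
      simp
  rw [Finset.sum_congr rfl fun g _ => key g, Finset.sum_sub_distrib]
  have htot : ∑ g : Fin τ → Bool, ∏ v, (if g v then x else 1 - x) = 1 := by
    have := Finset.prod_univ_sum (fun _ : Fin τ => (Finset.univ : Finset Bool))
      (fun _ b => if b then x else 1 - x)
    rw [Fintype.piFinset_univ] at this
    rw [← this]
    simp
  rw [htot]
  simp

end AbsorbingMaps

section ChaseCounting

open Matrix

variable {α : Type*} [DecidableEq α]

/-- The pairs whose image under a rule is left free when each `s ∈ S` must be followed by
`R s`. -/
abbrev FreePair (S : Finset α) (R : α → α) : Type _ :=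
  {z : α × α // ¬ (z.1 ∈ S ∧ z.2 = R z.1)}

/-- If the rule maps the free pair `v` to `d`, the chase moves to `(D v.1, d)`; it stops when that
pair is not free. -/
def chaseStep (S : Finset α) (R D : α → α) (v : FreePair S R) (d : α) :
    Option (FreePair S R) :=
  if h : v.1.1 ∈ S ∧ ¬ (D v.1.1 ∈ S ∧ d = R (D v.1.1)) then some ⟨(D v.1.1, d), h.2⟩ else none

theorem chaseStep_eq_some_iff (S : Finset α) (R D : α → α) (v u : FreePair S R) (d : α) :
    chaseStep S R D v d = some u ↔ d = u.1.2 ∧ v.1.1 ∈ S ∧ D v.1.1 = u.1.1 := by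
  obtain ⟨⟨u₁, u₂⟩, hu⟩ := u
  unfold chaseStep
  split_ifs with h
  · simp only [Option.some.injEq, Subtype.mk.injEq, Prod.mk.injEq]
    tauto
  · simp only [false_iff]
    rintro ⟨rfl, hv, rfl⟩
    exact h ⟨hv, hu⟩

theorem card_freePair_fst_eq [Fintype α] (S : Finset α) (R : α → α) {s : α} (hs : s ∈ S) :
    (Finset.univ.filter fun v : FreePair S R => v.1.1 = s).card = Fintype.card α - 1 := by
  rw [← Finset.card_univ, ← Finset.card_erase_of_mem (Finset.mem_univ (R s))]
  refine Finset.card_bij (fun v _ => v.1.2) ?_ ?_ ?_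
  · rintro ⟨⟨a, c⟩, hv⟩ h
    obtain rfl : a = s := by simpa using h
    simpa [hs] using hv
  · rintro ⟨⟨a, c⟩, hv⟩ h ⟨⟨a', c'⟩, hv'⟩ h' hc
    simp only [Finset.mem_filter, Finset.mem_univ, true_and] at h h' hc
    simp [h, h', hc]
  · intro c hc
    exact ⟨⟨(s, c), fun h => (Finset.mem_erase.mp hc).1 h.2⟩, by simp, rfl⟩

theorem card_absorbing_chaseStep [Fintype α] [Nonempty α] (S : Finset α) (R D : α → α) :
    (Nat.card {h : FreePair S R → α // Absorbing fun v => chaseStep S R D v (h v)} : ℝ) =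
      (Fintype.card α : ℝ) ^ Fintype.card (FreePair S R) *
        (Matrix.of fun p q : S => (1 : Matrix S S ℝ) p q -
          if D p = q then ((Fintype.card α : ℝ) - 1) / Fintype.card α else 0).det := by
  classical
  have hn : (Fintype.card α : ℝ) ≠ 0 := by exact_mod_cast Fintype.card_ne_zero
  have hcard : (Nat.card {h : FreePair S R → α // Absorbing fun v => chaseStep S R D v (h v)} : ℝ)
      = ∑ h : FreePair S R → α, (∏ _v : FreePair S R, (1 : ℝ)) *
          (if Absorbing (fun v => chaseStep S R D v (h v)) then 1 else 0) := by
    rw [Nat.card_eq_fintype_card, Fintype.card_subtype]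
    simp
  rw [hcard, sum_prod_absorbing_eq_det (chaseStep S R D) fun _ _ => 1]
  set A : Matrix (FreePair S R) S ℝ :=
    Matrix.of fun v s => if v.1.1 = s then (Fintype.card α : ℝ)⁻¹ else 0 with hA
  set B : Matrix S (FreePair S R) ℝ := Matrix.of fun s u => if D s = u.1.1 then 1 else 0 with hB
  have h₁ : (Matrix.of fun v u => ∑ d : α, (1 : ℝ) *
      ((1 : Matrix (FreePair S R) (FreePair S R) ℝ) v u -
        if chaseStep S R D v d = some u then 1 else 0)) =
      (Fintype.card α : ℝ) • (1 - A * B) := by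
    ext v u
    simp only [chaseStep_eq_some_iff, one_mul, Finset.sum_sub_distrib, Matrix.of_apply,
      Matrix.smul_apply, Matrix.sub_apply, Matrix.mul_apply, hA, hB, ite_and]
    by_cases hv : v.1.1 ∈ S
    · rw [Finset.sum_eq_single (⟨v.1.1, hv⟩ : S)]
      · by_cases hD : D v.1.1 = u.1.1 <;> simp [hv, hD, mul_sub, hn]
      · rintro ⟨b, hb⟩ - hne
        have : v.1.1 ≠ b := fun h => hne (Subtype.ext h.symm)
        simp [this]
      · simp
    · rw [Finset.sum_eq_zero (s := (Finset.univ : Finset S))]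
      · simp [hv]
      · rintro ⟨b, hb⟩ -
        have : v.1.1 ≠ b := fun h => hv (h ▸ hb)
        simp [this]
  have h₂ : (Matrix.of fun p q : S => (1 : Matrix S S ℝ) p q -
      if D p = q then ((Fintype.card α : ℝ) - 1) / Fintype.card α else 0) = 1 - B * A := by
    ext s s'
    simp only [Matrix.of_apply, Matrix.sub_apply, Matrix.mul_apply, hA, hB]
    congr 1
    have : ∀ v : FreePair S R, ((if D s = v.1.1 then (1 : ℝ) else 0) *
        if v.1.1 = (s' : α) then (Fintype.card α : ℝ)⁻¹ else 0) =
        if v.1.1 = s' then (if D s = s' then (Fintype.card α : ℝ)⁻¹ else 0) else 0 := by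
      intro v
      by_cases h : v.1.1 = (s' : α) <;> simp [h]
    rw [Finset.sum_congr rfl fun v _ => this v, ← Finset.sum_filter, Finset.sum_const,
      card_freePair_fst_eq S R s'.2, nsmul_eq_mul, Nat.cast_sub Fintype.card_pos]
    split_ifs <;> simp [div_eq_mul_inv]
  rw [h₁, Matrix.det_smul, h₂, Matrix.det_one_sub_mul_comm]

/-- Rules with the prescribed values on non-free pairs correspond to functions on free pairs. -/
theorem bijective_restrict_freePair (S : Finset α) (R D : α → α) :
    Function.Bijective fun (f : {f : α → α → α // ∀ s ∈ S, f s (R s) = R (D s)})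
      (v : FreePair S R) => f.1 v.1.1 v.1.2 := by
  constructor
  · rintro ⟨f, hf⟩ ⟨g, hg⟩ h
    refine Subtype.ext (funext fun a => funext fun b => ?_)
    by_cases hz : a ∈ S ∧ b = R a
    · obtain ⟨ha, rfl⟩ := hz
      exact (hf a ha).trans (hg a ha).symm
    · exact congrFun h ⟨(a, b), hz⟩
  · intro h
    refine ⟨⟨fun a b => if hz : a ∈ S ∧ b = R a then R (D a) else h ⟨(a, b), hz⟩, ?_⟩, ?_⟩
    · intro s hs
      simp [hs]
    · ext v
      simp only [dif_neg v.2]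

theorem card_rules_eq [Fintype α] (S : Finset α) (R D : α → α) :
    Nat.card {f : α → α → α // ∀ s ∈ S, f s (R s) = R (D s)} =
      Fintype.card α ^ Fintype.card (FreePair S R) := by
  rw [Nat.card_eq_of_bijective _ (bijective_restrict_freePair S R D), Nat.card_eq_fintype_card,
    Fintype.card_fun]

theorem card_absorbing_rules_eq (S : Finset α) (R D : α → α) :
    Nat.card {f : α → α → α // (∀ s ∈ S, f s (R s) = R (D s)) ∧
        Absorbing fun v => chaseStep S R D v (f v.1.1 v.1.2)} =
      Nat.card {h : FreePair S R → α // Absorbing fun v => chaseStep S R D v (h v)} := by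
  refine Nat.card_congr ((Equiv.subtypeSubtypeEquivSubtypeInter _ _).symm.trans ?_)
  exact (Equiv.ofBijective _ (bijective_restrict_freePair S R D)).subtypeEquiv fun _ => Iff.rfl

end ChaseCounting

section Tiles

variable {n τ σ : ℕ} {T : ℕ → ℕ → Fin n}

theorem IsTilePeriodic.apply_mod (h : IsTilePeriodic τ σ T) (i j : ℕ) :
    T (i % τ) (j % σ) = T i j := by
  have h₁ : Function.Periodic (fun i => T i (j % σ)) τ := fun i => h.1 i _
  have h₂ : Function.Periodic (T i) σ := h.2 i
  exact (h₁.map_mod_nat i).trans (h₂.map_mod_nat j)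

theorem IsTilePeriodic.apply_add_mul (h : IsTilePeriodic τ σ T) (i j k m : ℕ) :
    T (i + k * τ) (j + m * σ) = T i j := by
  rw [← h.apply_mod, Nat.add_mul_mod_self_right, Nat.add_mul_mod_self_right, h.apply_mod]

theorem IsTilePeriodic.mem_tileStates (h : IsTilePeriodic τ σ T) (hτ : 1 ≤ τ) (hσ : 1 ≤ σ)
    (i j : ℕ) : T i j ∈ tileStates n τ σ T := by
  refine Finset.mem_image.mpr ⟨(i % τ, j % σ), ?_, h.apply_mod i j⟩
  simp [Nat.mod_lt _ hτ, Nat.mod_lt _ hσ]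

theorem IsTilePeriodic.mem_tilePairs (h : IsTilePeriodic τ σ T) (hτ : 1 ≤ τ) (hσ : 1 ≤ σ)
    (i j : ℕ) : (T i j, T i (j + 1)) ∈ tilePairs n τ σ T := by
  refine Finset.mem_image.mpr ⟨(i % τ, j % σ), ?_, ?_⟩
  · simp [Nat.mod_lt _ hτ, Nat.mod_lt _ hσ]
  · refine Prod.ext (h.apply_mod i j) ?_
    dsimp only
    rw [← h.apply_mod, ← h.apply_mod i (j + 1), Nat.mod_mod, Nat.mod_add_mod]

theorem exists_of_mem_tileStates {s : Fin n} (hs : s ∈ tileStates n τ σ T) :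
    ∃ i j, T i j = s := by
  obtain ⟨p, -, hp⟩ := Finset.mem_image.mp hs
  exact ⟨p.1, p.2, hp⟩

theorem image_fst_tilePairs :
    (tilePairs n τ σ T).image Prod.fst = tileStates n τ σ T := by
  simp only [tilePairs, tileStates, Finset.image_image]
  rfl

theorem IsTilePeriodic.image_snd_tilePairs (h : IsTilePeriodic τ σ T) (hτ : 1 ≤ τ)
    (hσ : 1 ≤ σ) : (tilePairs n τ σ T).image Prod.snd = tileStates n τ σ T := by
  ext s
  constructor
  · intro hs
    obtain ⟨p, hp, rfl⟩ := Finset.mem_image.mp hs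
    obtain ⟨q, -, rfl⟩ := Finset.mem_image.mp hp
    exact h.mem_tileStates hτ hσ _ _
  · intro hs
    obtain ⟨i, j, rfl⟩ := exists_of_mem_tileStates hs
    refine Finset.mem_image.mpr ⟨_, h.mem_tilePairs hτ hσ i (j + (σ - 1)), ?_⟩
    dsimp only
    rw [show j + (σ - 1) + 1 = j + σ by omega, h.2]

theorem IsPSTile.right_eq (hT : IsPSTile n τ σ T) (hsimple : IsSimpleTile n τ σ T)
    (hτ : 1 ≤ τ) (hσ : 1 ≤ σ) {i j k m : ℕ} (h : T i j = T k m) : T i (j + 1) = T k (m + 1) := by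
  have hinj : Set.InjOn Prod.fst (tilePairs n τ σ T : Set (Fin n × Fin n)) := by
    rw [← Finset.card_image_iff, image_fst_tilePairs]
    exact hsimple.symm
  exact congrArg Prod.snd
    (hinj (hT.1.mem_tilePairs hτ hσ i j) (hT.1.mem_tilePairs hτ hσ k m) h)

theorem IsPSTile.left_eq (hT : IsPSTile n τ σ T) (hsimple : IsSimpleTile n τ σ T)
    (hτ : 1 ≤ τ) (hσ : 1 ≤ σ) {i j k m : ℕ} (h : T i (j + 1) = T k (m + 1)) : T i j = T k m := by
  have hinj : Set.InjOn Prod.snd (tilePairs n τ σ T : Set (Fin n × Fin n)) := by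
    rw [← Finset.card_image_iff, hT.1.image_snd_tilePairs hτ hσ]
    exact hsimple.symm
  exact congrArg Prod.fst
    (hinj (hT.1.mem_tilePairs hτ hσ i j) (hT.1.mem_tilePairs hτ hσ k m) h)

theorem IsPSTile.down_eq (hT : IsPSTile n τ σ T) (hsimple : IsSimpleTile n τ σ T)
    (hτ : 1 ≤ τ) (hσ : 1 ≤ σ) {i j k m : ℕ} (h : T i j = T k m) : T (i + 1) j = T (k + 1) m :=
  hT.left_eq hsimple hτ hσ (hT.2.1 i j k m h (hT.right_eq hsimple hτ hσ h))

theorem IsPSTile.shift_eq (hT : IsPSTile n τ σ T) (hsimple : IsSimpleTile n τ σ T)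
    (hτ : 1 ≤ τ) (hσ : 1 ≤ σ) {i j k m : ℕ} (h : T i j = T k m) (s t : ℕ) :
    T (i + s) (j + t) = T (k + s) (m + t) := by
  induction t with
  | zero =>
    induction s with
    | zero => exact h
    | succ s ih => exact hT.down_eq hsimple hτ hσ ih
  | succ t ih => exact hT.right_eq hsimple hτ hσ ih

theorem IsPSTile.column_injOn (hT : IsPSTile n τ σ T) (hsimple : IsSimpleTile n τ σ T)
    (hτ : 1 ≤ τ) (hσ : 1 ≤ σ) (j : ℕ) : Set.InjOn (fun i => T i j) (Set.Iio τ) := by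
  have key : ∀ i k, i < k → k < τ → T i j ≠ T k j := by
    intro i k hik hk h
    have hper : ∀ s t, T (s + (k - i)) t = T s t := by
      intro s t
      have h' := hT.shift_eq hsimple hτ hσ h (s + i * τ - i) (t + j * σ - j)
      have hi : i ≤ i * τ := Nat.le_mul_of_pos_right i hτ
      have hj : j ≤ j * σ := Nat.le_mul_of_pos_right j hσ
      rw [show i + (s + i * τ - i) = s + i * τ by omega,
        show j + (t + j * σ - j) = t + j * σ by omega,
        show k + (s + i * τ - i) = s + (k - i) + i * τ by omega,
        hT.1.apply_add_mul, hT.1.apply_add_mul] at h'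
      exact h'.symm
    have := hT.2.2.2 (k - i) (by omega) hper
    omega
  intro i hi k hk h
  rcases lt_trichotomy i k with hlt | heq | hgt
  · exact absurd h (key i k hlt hk)
  · exact heq
  · exact absurd h.symm (key k i hgt hi)

/-- A simple tile has `tileRank` columns that together contain each state of the tile exactly
once. -/
theorem IsPSTile.exists_columns (hT : IsPSTile n τ σ T) (hsimple : IsSimpleTile n τ σ T)
    (hτ : 1 ≤ τ) (hσ : 1 ≤ σ) :
    ∃ J : Finset ℕ, J.card = tileRank n τ σ T ∧
      Set.InjOn (fun p : ℕ × ℕ => T p.2 p.1) (J ×ˢ Finset.range τ : Finset (ℕ × ℕ)) ∧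
      ∀ i j, ∃ m ∈ J, ∃ k < τ, T k m = T i j := by
  set X := {x : ℕ | ∃ J : Finset ℕ, J ⊆ Finset.range σ ∧ J.card = x ∧
    ((J ×ˢ Finset.range τ).image fun p => T p.2 p.1).card = x * τ} with hX
  have hbdd : BddAbove X := by
    refine ⟨σ, ?_⟩
    rintro x ⟨J, hJ, rfl, -⟩
    simpa using Finset.card_le_card hJ
  obtain ⟨J, hJσ, hJ, hcard⟩ := Nat.sSup_mem (s := X) ⟨0, ∅, by simp⟩ hbdd
  have hinj : Set.InjOn (fun p : ℕ × ℕ => T p.2 p.1)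
      (J ×ˢ Finset.range τ : Finset (ℕ × ℕ)) := by
    rw [← Finset.card_image_iff, hcard, Finset.card_product, Finset.card_range, hJ]
  refine ⟨J, hJ, hinj, ?_⟩
  by_contra! hc
  obtain ⟨i₀, j₀, hij⟩ := hc
  have hdisj : ∀ m ∈ J, ∀ i k, T k m ≠ T i (j₀ % σ) := by
    intro m hm i k h
    have hi₀ : i ≤ i * τ := Nat.le_mul_of_pos_right i hτ
    have h' := hT.shift_eq hsimple hτ hσ h (i₀ + i * τ - i) 0
    rw [show i + (i₀ + i * τ - i) = i₀ + i * τ by omega, Nat.add_zero, Nat.add_zero,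
      ← hT.1.apply_mod (i₀ + i * τ), Nat.add_mul_mod_self_right, Nat.mod_mod,
      hT.1.apply_mod] at h'
    refine hij m hm ((k + (i₀ + i * τ - i)) % τ) (Nat.mod_lt _ hτ) ?_
    rw [← h', ← hT.1.apply_mod _ m, Nat.mod_mod, hT.1.apply_mod]
  have hnot : j₀ % σ ∉ J := fun hm => hdisj _ hm 0 0 rfl
  have hmem : sSup X + 1 ∈ X := by
    refine ⟨insert (j₀ % σ) J, ?_, by rw [Finset.card_insert_of_notMem hnot, hJ], ?_⟩
    · exact Finset.insert_subset (Finset.mem_range.mpr (Nat.mod_lt _ hσ)) hJσ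
    · rw [← hJ, ← Finset.card_insert_of_notMem hnot]
      conv_rhs => rw [← Finset.card_range τ, ← Finset.card_product]
      rw [Finset.card_image_iff]
      rintro ⟨a, i⟩ ha ⟨b, k⟩ hb h
      simp only [Finset.coe_product, Set.mem_prod, Finset.mem_coe, Finset.mem_insert,
        Finset.mem_range] at ha hb
      dsimp only at h
      rcases ha with ⟨rfl | ha, hi⟩ <;> rcases hb with ⟨rfl | hb, hk⟩
      · rw [hT.column_injOn hsimple hτ hσ _ hi hk h]
      · exact absurd h.symm (hdisj b hb i k)
      · exact absurd h (hdisj a ha k i)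
      · exact hinj (by simp [ha, hi]) (by simp [hb, hk]) h
  have := le_csSup hbdd hmem
  omega

theorem IsPSTile.exists_right (hT : IsPSTile n τ σ T) (hsimple : IsSimpleTile n τ σ T)
    (hτ : 1 ≤ τ) (hσ : 1 ≤ σ) :
    ∃ R : Fin n → Fin n, ∀ i j, R (T i j) = T i (j + 1) := by
  have h : Function.FactorsThrough (fun p : ℕ × ℕ => T p.1 (p.2 + 1)) (fun p => T p.1 p.2) :=
    fun p q hpq => hT.right_eq hsimple hτ hσ hpq
  exact ⟨Function.extend _ _ id, fun i j => h.extend_apply id (i, j)⟩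

theorem IsPSTile.exists_down (hT : IsPSTile n τ σ T) (hsimple : IsSimpleTile n τ σ T)
    (hτ : 1 ≤ τ) (hσ : 1 ≤ σ) :
    ∃ D : Fin n → Fin n, ∀ i j, D (T i j) = T (i + 1) j := by
  have h : Function.FactorsThrough (fun p : ℕ × ℕ => T (p.1 + 1) p.2) (fun p => T p.1 p.2) :=
    fun p q hpq => hT.down_eq hsimple hτ hσ hpq
  exact ⟨Function.extend _ _ id, fun i j => h.extend_apply id (i, j)⟩

theorem IsPSTile.det_down (hT : IsPSTile n τ σ T) (hsimple : IsSimpleTile n τ σ T)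
    (hτ : 1 ≤ τ) (hσ : 1 ≤ σ) {D : Fin n → Fin n} (hD : ∀ i j, D (T i j) = T (i + 1) j) (x : ℝ) :
    (Matrix.of fun p q : tileStates n τ σ T =>
      (1 : Matrix (tileStates n τ σ T) (tileStates n τ σ T) ℝ) p q -
        if D p = q then x else 0).det = (1 - x ^ τ) ^ tileRank n τ σ T := by
  obtain ⟨J, hJ, hinj, hsurj⟩ := hT.exists_columns hsimple hτ hσ
  let φ : Fin τ × J → tileStates n τ σ T :=
    fun p => ⟨T p.1 p.2, hT.1.mem_tileStates hτ hσ _ _⟩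
  have hφinj : Function.Injective φ := by
    rintro ⟨i, a⟩ ⟨k, b⟩ h
    have h' := @hinj (a, i) (by simp) (b, k) (by simp) (congrArg Subtype.val h)
    simp only [Prod.mk.injEq] at h'
    exact Prod.ext (Fin.ext h'.2) (Subtype.ext h'.1)
  have hφ : Function.Bijective φ := by
    refine ⟨hφinj, ?_⟩
    rintro ⟨s, hs⟩
    obtain ⟨i, j, rfl⟩ := exists_of_mem_tileStates hs
    obtain ⟨m, hm, k, hk, h⟩ := hsurj i j
    exact ⟨(⟨k, hk⟩, ⟨m, hm⟩), Subtype.ext h⟩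
  have hDφ : ∀ p, D (φ p) = φ (cycSucc p.1, p.2) := by
    intro p
    simp only [φ, cycSucc, hD]
    rw [← hT.1.apply_mod (p.1 + 1) p.2, ← hT.1.apply_mod ((p.1 + 1) % τ) p.2, Nat.mod_mod]
  have hblock : (Matrix.of fun p q : tileStates n τ σ T =>
      (1 : Matrix (tileStates n τ σ T) (tileStates n τ σ T) ℝ) p q -
        if D p = q then x else 0).submatrix (Equiv.ofBijective φ hφ) (Equiv.ofBijective φ hφ) =
      Matrix.blockDiagonal fun _ : J => Matrix.of fun p q : Fin τ =>
        (1 : Matrix (Fin τ) (Fin τ) ℝ) p q - if cycSucc p = q then x else 0 := by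
    ext ⟨p, a⟩ ⟨q, b⟩
    simp only [Matrix.submatrix_apply, Matrix.of_apply, Equiv.ofBijective_apply,
      Matrix.blockDiagonal_apply, Matrix.one_apply, hDφ, hφinj.eq_iff, ← Subtype.ext_iff,
      Prod.mk.injEq]
    by_cases hab : a = b <;> simp [hab]
  rw [← Matrix.det_submatrix_equiv_self (Equiv.ofBijective φ hφ), hblock,
    Matrix.det_blockDiagonal]
  simp only [det_one_sub_smul_cycSucc hτ, Finset.prod_const, Finset.card_univ,
    Fintype.card_coe, hJ]

end Tiles

section Deciding

variable {n τ σ : ℕ} {T : ℕ → ℕ → Fin n}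

theorem chaseSeq_add (f : CARule n) (A : ℕ → Fin n) (c : Fin n) (m k : ℕ) :
    chaseSeq f A c (m + k) = chaseSeq f (fun i => A (m + i)) (chaseSeq f A c m) k := by
  induction k with
  | zero => rfl
  | succ k ih => rw [← Nat.add_assoc, chaseSeq, ih, chaseSeq]

variable {R D : Fin n → Fin n} (f : CARule n)

/-- From row `i` of column `j`, the chase stops exactly when it meets the next column. -/
theorem exists_iterate_chaseStep_eq_none_iff (hper : IsTilePeriodic τ σ T) (hτ : 1 ≤ τ)
    (hσ : 1 ≤ σ) (hR : ∀ i j, R (T i j) = T i (j + 1)) (hD : ∀ i j, D (T i j) = T (i + 1) j)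
    (i j : ℕ) (v : FreePair (tileStates n τ σ T) R) (hv : v.1.1 = T i j) :
    (∃ k : ℕ, (fun o => o.bind fun v => chaseStep (tileStates n τ σ T) R D v (f v.1.1 v.1.2))^[k]
        (some v) = none) ↔
      ∃ k, chaseSeq f (fun s => T (i + s) j) v.1.2 k = T (i + k) (j + 1) := by
  set step : Option (FreePair (tileStates n τ σ T) R) → Option _ :=
    fun o => o.bind fun v => chaseStep (tileStates n τ σ T) R D v (f v.1.1 v.1.2) with hstep
  constructor
  · rintro ⟨k, hk⟩
    by_contra! hc
    have : ∀ k, ∃ u, step^[k] (some v) = some u ∧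
        u.1 = (T (i + k) j, chaseSeq f (fun s => T (i + s) j) v.1.2 k) := by
      intro k
      induction k with
      | zero => exact ⟨v, rfl, Prod.ext hv rfl⟩
      | succ k ih =>
        obtain ⟨u, hu, hu'⟩ := ih
        refine ⟨⟨(T (i + (k + 1)) j, chaseSeq f (fun s => T (i + s) j) v.1.2 (k + 1)), ?_⟩, ?_, rfl⟩
        · rw [hR]
          exact fun h => hc (k + 1) h.2
        · rw [Function.iterate_succ_apply', hu]
          simp only [hstep, Option.bind_some]
          rw [chaseStep_eq_some_iff, hu']
          exact ⟨rfl, hper.mem_tileStates hτ hσ _ _, hD _ _⟩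
    obtain ⟨u, hu, -⟩ := this k
    simp [hu] at hk
  · rintro ⟨k, hk⟩
    by_contra! hc
    have : ∀ k, ∃ u, step^[k] (some v) = some u ∧
        u.1 = (T (i + k) j, chaseSeq f (fun s => T (i + s) j) v.1.2 k) := by
      intro k
      induction k with
      | zero => exact ⟨v, rfl, Prod.ext hv rfl⟩
      | succ k ih =>
        obtain ⟨u, hu, hu'⟩ := ih
        obtain ⟨w, hw⟩ := Option.ne_none_iff_exists'.mp (hc (k + 1))
        refine ⟨w, hw, ?_⟩
        rw [Function.iterate_succ_apply', hu] at hw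
        simp only [hstep, Option.bind_some] at hw
        rw [chaseStep_eq_some_iff, hu', hD] at hw
        exact Prod.ext hw.2.2.symm hw.1.symm
    obtain ⟨u, -, hu⟩ := this k
    refine u.2 ?_
    rw [hu, hR]
    exact ⟨hper.mem_tileStates hτ hσ _ _, hk⟩

theorem forall_rightExtends_iff (hper : IsTilePeriodic τ σ T) (hτ : 1 ≤ τ) (hσ : 1 ≤ σ)
    (hR : ∀ i j, R (T i j) = T i (j + 1)) (hD : ∀ i j, D (T i j) = T (i + 1) j) :
    (∀ j < σ, RightExtends f (fun i => T i j) (fun i => T i (j + 1))) ↔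
      ∀ s ∈ tileStates n τ σ T, f s (R s) = R (D s) := by
  constructor
  · intro h s hs
    obtain ⟨p, hp, rfl⟩ := Finset.mem_image.mp hs
    simp only [hR, hD]
    exact h p.2 (Finset.mem_range.mp (Finset.mem_product.mp hp).2) p.1
  · intro h j _ i
    have := h _ (hper.mem_tileStates hτ hσ i j)
    rwa [hD, hR, hR] at this

theorem forall_exists_chaseSeq_eq_iff (hper : IsTilePeriodic τ σ T) (hτ : 1 ≤ τ) (hσ : 1 ≤ σ)
    (hR : ∀ i j, R (T i j) = T i (j + 1)) (hD : ∀ i j, D (T i j) = T (i + 1) j) :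
    (∀ j < σ, ∀ c, ∃ k, chaseSeq f (fun i => T i j) c k = T k (j + 1)) ↔
      Absorbing fun v => chaseStep (tileStates n τ σ T) R D v (f v.1.1 v.1.2) := by
  constructor
  · intro h v
    by_cases hv : v.1.1 ∈ tileStates n τ σ T
    · obtain ⟨⟨i, j⟩, hp, hij⟩ := Finset.mem_image.mp hv
      simp only [Finset.mem_product, Finset.mem_range] at hp
      rw [exists_iterate_chaseStep_eq_none_iff f hper hτ hσ hR hD i j v hij.symm]
      obtain ⟨k, hk⟩ := h j hp.2 (chaseSeq f (fun s => T (i + s) j) v.1.2 (τ - i))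
      refine ⟨τ - i + k, ?_⟩
      have hrow : ∀ s m, T (i + (τ - i + s)) m = T s m := by
        intro s m
        rw [show i + (τ - i + s) = s + τ by omega, hper.1]
      rw [chaseSeq_add, hrow, ← hk]
      simp only [hrow]
    · exact ⟨1, by simp [chaseStep, hv]⟩
  · intro h j _ c
    by_cases hc : c = T 0 (j + 1)
    · exact ⟨0, hc⟩
    · have := (exists_iterate_chaseStep_eq_none_iff f hper hτ hσ hR hD 0 j
        ⟨(T 0 j, c), fun h => hc (h.2.trans (hR 0 j))⟩ rfl).mp (h _)
      simpa using this

end Deciding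

/-- for a simple tile of a periodic solution with rank `y`, the
conditional probability (over a uniformly random rule) that every column decides
the next one, given that every column right-extends to the next one, equals
`((n^τ − (n−1)^τ)/n^τ)^y`. -/
theorem simple_tile_conditional_deciding_probability (n τ σ : ℕ)
    (hτ : 1 ≤ τ) (hσ : 1 ≤ σ) (T : ℕ → ℕ → Fin n)
    (hT : IsPSTile n τ σ T) (hsimple : IsSimpleTile n τ σ T) :
    (Nat.card {f : CARule n //
        ∀ j < σ, Decides f (fun i => T i j) (fun i => T i (j + 1))} : ℝ) /
      (Nat.card {f : CARule n //
        ∀ j < σ, RightExtends f (fun i => T i j) (fun i => T i (j + 1))} : ℝ)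
      = (((n : ℝ) ^ τ - ((n : ℝ) - 1) ^ τ) / (n : ℝ) ^ τ) ^ tileRank n τ σ T := by
  obtain ⟨R, hR⟩ := hT.exists_right hsimple hτ hσ
  obtain ⟨D, hD⟩ := hT.exists_down hsimple hτ hσ
  have : Nonempty (Fin n) := ⟨T 0 0⟩
  have hn : (n : ℝ) ≠ 0 := by exact_mod_cast (T 0 0).pos.ne'
  have hgood : Nat.card {f : CARule n //
      ∀ j < σ, Decides f (fun i => T i j) (fun i => T i (j + 1))} =
      Nat.card {f : CARule n // (∀ s ∈ tileStates n τ σ T, f s (R s) = R (D s)) ∧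
        Absorbing fun v => chaseStep (tileStates n τ σ T) R D v (f v.1.1 v.1.2)} := by
    refine Nat.card_congr (Equiv.subtypeEquivRight fun f => ?_)
    rw [← forall_rightExtends_iff f hT.1 hτ hσ hR hD,
      ← forall_exists_chaseSeq_eq_iff f hT.1 hτ hσ hR hD]
    simp only [Decides, forall_and]
  have htotal : Nat.card {f : CARule n //
      ∀ j < σ, RightExtends f (fun i => T i j) (fun i => T i (j + 1))} =
      Nat.card {f : CARule n // ∀ s ∈ tileStates n τ σ T, f s (R s) = R (D s)} :=
    Nat.card_congr (Equiv.subtypeEquivRight fun f =>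
      forall_rightExtends_iff f hT.1 hτ hσ hR hD)
  rw [hgood, htotal, card_absorbing_rules_eq, card_absorbing_chaseStep, card_rules_eq,
    hT.det_down hsimple hτ hσ hD, Fintype.card_fin, Nat.cast_pow,
    mul_div_cancel_left₀ _ (pow_ne_zero _ hn), div_pow, sub_div, div_self (pow_ne_zero _ hn)]
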